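/- The spectral norm of the infinite Hilbert matrix A = [1/(k+ℓ-1)]_{k,ℓ≥1}, viewed as a bounded operator on ℓ²(ℕ), equals π. In particular, for any unit vectors γ, δ ∈ ℓ², |∑_{k,ℓ} γ_k δ_ℓ/(k+ℓ-1)| ≤ π. -/

import Mathlib

open scoped BigOperators

lemma hm_mid_conv (a m t : ℝ) (ha : 0 < a) (ht : 0 ≤ t) (htm : t < m) :
    2 * (1 / ((a + m) * √m)) ≤ 1 / ((a + (m + t)) * √(m + t)) + 1 / ((a + (m - t)) * √(m - t)) := by
  have h1 : 0 < m - t := by linarith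
  have h2 : 0 < m + t := by linarith
  have hm : 0 < m := by linarith
  set p := √(m+t) with hp
  set q := √(m-t) with hq
  set r := √m with hr
  have p0 : 0 < p := Real.sqrt_pos.2 h2
  have q0 : 0 < q := Real.sqrt_pos.2 h1
  have r0 : 0 < r := Real.sqrt_pos.2 hm
  have p2 : p^2 = m + t := Real.sq_sqrt h2.le
  have q2 : q^2 = m - t := Real.sq_sqrt h1.le
  have r2 : r^2 = m := Real.sq_sqrt hm.le
  have hpq : p * q ≤ r^2 := by nlinarith [sq_nonneg (p-q)]
  set u := (a + (m + t)) * p with hu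
  set v := (a + (m - t)) * q with hv
  set w := (a+m) * r with hw
  have u0 : 0 < u := by positivity
  have v0 : 0 < v := by positivity
  have w0 : 0 < w := by positivity
  have huv : u * v ≤ w^2 := by
    have e1 : (a + (m + t)) * (a + (m - t)) ≤ (a+m)^2 := by nlinarith [sq_nonneg t]
    calc u * v = ((a + (m + t)) * (a + (m - t))) * (p * q) := by rw [hu, hv]; ring
      _ ≤ (a+m)^2 * r^2 := by gcongr
      _ = w^2 := by rw [hw]; ring
  have h3 : (1/w)^2 ≤ (1/u) * (1/v) := by
    rw [div_pow, one_pow, div_mul_div_comm, one_mul]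
    exact one_div_le_one_div_of_le (by positivity) huv
  have : 0 < 1/u := by positivity
  have : 0 < 1/v := by positivity
  have : 0 < 1/w := by positivity
  have := abs_le_of_sq_le_sq (a := 2*(1/w)) (b := 1/u + 1/v) (by nlinarith [sq_nonneg (1/u-1/v)]) (by positivity)
  exact (le_abs_self _).trans this

lemma hm_deriv (a x : ℝ) (ha : 0 < a) (hx : 0 < x) :
    HasDerivAt (fun x => 2 / √a * Real.arctan (√x / √a)) (1 / ((a + x) * √x)) x := by
  have h := (((Real.hasDerivAt_sqrt hx.ne').div_const (√a)).arctan).const_mul (2 / √a)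
  refine h.congr_deriv ?_
  have r0 : 0 < √x := Real.sqrt_pos.2 hx
  have s0 : 0 < √a := Real.sqrt_pos.2 ha
  have r2 : √x^2 = x := Real.sq_sqrt hx.le
  have s2 : √a^2 = a := Real.sq_sqrt ha.le
  rw [div_pow, r2, s2]
  field_simp
  try rw [s2]

lemma hm_mid (a m : ℝ) (ha : 0 < a) (hm : 1/2 ≤ m) :
    1 / ((a + m) * √m) ≤ 2 / √a * Real.arctan (√(m+1/2) / √a)
      - 2 / √a * Real.arctan (√(m-1/2) / √a) := by
  let F : ℝ → ℝ := fun x => 2 / √a * Real.arctan (√x / √a)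
  have hF : Continuous F := by fun_prop
  let g : ℝ → ℝ := fun t => F (m+t) - F (m-t) - 2 * t * (1 / ((a + m) * √m))
  have hg : MonotoneOn g (Set.Icc 0 (1/2)) := by
    have hd : ∀ t ∈ interior (Set.Icc (0:ℝ) (1/2)), HasDerivAt g
      (1 / ((a + (m + t)) * √(m + t)) + 1 / ((a + (m - t)) * √(m - t)) - 2 * (1 / ((a + m) * √m))) t := by
      intro t ht
      rw [interior_Icc] at ht
      have e1 : HasDerivAt F _ (m+t) := hm_deriv a (m+t) ha (by linarith [ht.1])
      have e2 : HasDerivAt F _ (m-t) := hm_deriv a (m-t) ha (by linarith [ht.2])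
      have e1' := e1.comp t ((hasDerivAt_id t).const_add m)
      have e2' := e2.comp t ((hasDerivAt_id t).const_sub m)
      have e3 := ((hasDerivAt_id t).const_mul 2).mul_const (1 / ((a + m) * √m))
      exact ((e1'.sub e2').sub e3).congr_deriv (by ring)
    apply monotoneOn_of_deriv_nonneg (convex_Icc _ _)
    · fun_prop
    · intro t ht
      exact (hd t ht).differentiableAt.differentiableWithinAt
    · intro t ht
      rw [(hd t ht).deriv]
      rw [interior_Icc] at ht
      have := hm_mid_conv a m t ha ht.1.le (by linarith [ht.2])
      linarith
  have := hg (a := 0) (b := 1/2) (by norm_num) (by norm_num) (by norm_num)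
  simp only [g, F] at this
  simp only [add_zero, sub_zero, mul_zero, zero_mul, sub_self] at this
  linarith

/-- Schur row bound. -/
lemma hm_row_range (k n : ℕ) :
    ∑ l ∈ Finset.range n, 1 / ((k:ℝ) + l + 1) * (√(k+1/2) / √(l+1/2)) ≤ Real.pi := by
  have ha : (0:ℝ) < k + 1/2 := by positivity
  have s0 : 0 < √((k:ℝ)+1/2) := Real.sqrt_pos.2 ha
  have key : ∀ n : ℕ, ∑ l ∈ Finset.range n, 1 / ((k:ℝ) + l + 1) * (√(k+1/2) / √(l+1/2)) ≤
      2 * Real.arctan (√n / √((k:ℝ)+1/2)) := by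
    intro n
    induction n with
    | zero => simp
    | succ n ih =>
      rw [Finset.sum_range_succ]
      have h := hm_mid (k+1/2) (n+1/2) ha (by linarith [n.cast_nonneg (α := ℝ)])
      have h' := mul_le_mul_of_nonneg_left h s0.le
      have e : √((k:ℝ)+1/2) * (1 / ((k + 1 / 2 + (n + 1 / 2)) * √((n:ℝ) + 1 / 2))) =
        1 / ((k:ℝ) + n + 1) * (√(k+1/2) / √(n+1/2)) := by
        rw [show (k:ℝ) + 1 / 2 + (n + 1 / 2) = k + n + 1 by ring]
        field_simp
      rw [e, mul_sub, ← mul_assoc, ← mul_assoc, mul_div_cancel₀ _ s0.ne'] at h'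
      rw [show (n:ℝ)+1/2+1/2 = n+1 by ring, show (n:ℝ)+1/2-1/2 = n by ring] at h'
      push_cast
      linarith
  have := key n
  linarith [Real.arctan_lt_pi_div_two (√n / √((k:ℝ)+1/2))]

lemma hm_row (k : ℕ) (s : Finset ℕ) :
    ∑ l ∈ s, 1 / ((k:ℝ) + l + 1) * (√(k+1/2) / √(l+1/2)) ≤ Real.pi := by
  obtain ⟨n, hn⟩ := s.exists_nat_subset_range
  refine le_trans (Finset.sum_le_sum_of_subset_of_nonneg hn ?_) (hm_row_range k n)
  intros; positivity

lemma hm_schur (s t : Finset ℕ) (x : ℕ → ℝ) :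
    ∑ k ∈ s, (∑ l ∈ t, 1 / ((k:ℝ) + l + 1) * x l)^2 ≤ Real.pi^2 * ∑ l ∈ t, x l ^2 := by
  have h1 : ∀ k ∈ s, (∑ l ∈ t, 1 / ((k:ℝ) + l + 1) * x l)^2 ≤
      Real.pi * ∑ l ∈ t, 1 / ((k:ℝ) + l + 1) * (√(l+1/2) / √(k+1/2)) * x l ^2 := by
    intro k _
    refine le_trans (Finset.sum_sq_le_sum_mul_sum_of_sq_le_mul t
      (f := fun l => 1 / ((k:ℝ) + l + 1) * (√(k+1/2) / √(l+1/2)))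
      (g := fun l => 1 / ((k:ℝ) + l + 1) * (√(l+1/2) / √(k+1/2)) * x l ^2) ?_ ?_ ?_) ?_
    · intros; positivity
    · intros; positivity
    · intro l _
      have : 0 < √((k:ℝ)+1/2) := Real.sqrt_pos.2 (by positivity)
      have : 0 < √((l:ℝ)+1/2) := Real.sqrt_pos.2 (by positivity)
      refine le_of_eq ?_
      field_simp
    · exact mul_le_mul_of_nonneg_right (hm_row k t) (Finset.sum_nonneg (by intros; positivity))
  refine (Finset.sum_le_sum h1).trans ?_
  rw [← Finset.mul_sum, Finset.sum_comm, sq, mul_assoc]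
  refine mul_le_mul_of_nonneg_left ?_ Real.pi_pos.le
  rw [Finset.mul_sum]
  refine Finset.sum_le_sum fun l _ => ?_
  rw [← Finset.sum_mul]
  refine mul_le_mul_of_nonneg_right ?_ (sq_nonneg _)
  refine le_trans (le_of_eq ?_) (hm_row l s)
  refine Finset.sum_congr rfl fun k _ => ?_
  rw [add_comm (k:ℝ) l]

lemma hm_arctan_le {x : ℝ} (hx : 0 ≤ x) : Real.arctan x ≤ x := by
  have := Real.le_tan (Real.arctan_nonneg.2 hx) (Real.arctan_lt_pi_div_two x)
  rwa [Real.tan_arctan] at this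

lemma hm_low_step (a x : ℝ) (ha : 0 < a) (hx : 0 < x) :
    2 / √a * Real.arctan (√(x+1) / √a) - 2 / √a * Real.arctan (√x / √a) ≤ 1 / ((a + x) * √x) := by
  obtain ⟨c, hc, h⟩ := exists_hasDerivAt_eq_slope (fun x => 2 / √a * Real.arctan (√x / √a))
    (fun x => 1 / ((a + x) * √x)) (show x < x+1 by linarith) (by fun_prop)
    (fun y hy => hm_deriv a y ha (by linarith [hy.1]))
  simp only [add_sub_cancel_left, div_one] at h
  rw [← h]
  have := hc.1
  have := Real.sqrt_pos.2 hx
  have : 0 ≤ a + c := by linarith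
  gcongr

lemma hm_low_row (a : ℝ) (ha : 1 ≤ a) (N : ℕ) :
    Real.pi / √a - 2 / √(N+1:ℝ) - 2 / a ≤ ∑ l ∈ Finset.range N, 1 / ((a + (l+1)) * √(l+1:ℝ)) := by
  have a0 : 0 < a := by linarith
  have s0 : 0 < √a := Real.sqrt_pos.2 a0
  have n0 : 0 < √(N+1:ℝ) := Real.sqrt_pos.2 (by positivity)
  have s2 : √a * √a = a := Real.mul_self_sqrt a0.le
  have key : 2 / √a * Real.arctan (√(N+1:ℝ) / √a) - 2 / √a * Real.arctan (1 / √a) ≤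
      ∑ l ∈ Finset.range N, 1 / ((a + (l+1)) * √(l+1:ℝ)) := by
    induction N with
    | zero => simp
    | succ n ih =>
      rw [Finset.sum_range_succ]
      have h := hm_low_step a (n+1) a0 (by positivity)
      have := ih (Real.sqrt_pos.2 (by positivity))
      push_cast
      linarith
  refine le_trans ?_ key
  have h1 : Real.arctan (√(N+1:ℝ) / √a) = Real.pi/2 - Real.arctan (√a / √(N+1:ℝ)) := by
    rw [← Real.arctan_inv_of_pos (by positivity), inv_div]
  have h2 : Real.arctan (√a / √(N+1:ℝ)) ≤ √a / √(N+1:ℝ) := hm_arctan_le (by positivity)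
  have h3 : Real.arctan (1 / √a) ≤ 1 / √a := hm_arctan_le (by positivity)
  rw [h1]
  calc Real.pi / √a - 2 / √(N+1:ℝ) - 2 / a
      = 2 / √a * (Real.pi / 2 - √a / √(N+1:ℝ)) - 2 / √a * (1 / √a) := by
        rw [div_mul_div_comm 2 (√a), s2]; field_simp
    _ ≤ _ := by gcongr

lemma hm_sum_inv_sqrt (N : ℕ) : ∑ k ∈ Finset.range N, 1 / √(k+1:ℝ) ≤ 2 * √N := by
  induction N with
  | zero => simp
  | succ n ih =>
    rw [Finset.sum_range_succ]
    push_cast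
    have h1 : 0 < √(n+1:ℝ) := Real.sqrt_pos.2 (by positivity)
    have h2 : √(n+1:ℝ)^2 = n+1 := Real.sq_sqrt (by positivity)
    have h3 : √(n:ℝ)^2 = n := Real.sq_sqrt (by positivity)
    have : 1 / √(n+1:ℝ) ≤ 2 * √(n+1:ℝ) - 2 * √n := by
      rw [div_le_iff₀ h1]
      nlinarith [sq_nonneg (√(n+1:ℝ) - √n)]
    linarith

lemma hm_low : ∃ C : ℝ, ∀ N : ℕ, Real.pi * ∑ k ∈ Finset.range N, 1 / (k+1:ℝ) - C ≤
    ∑ k ∈ Finset.range N, ∑ l ∈ Finset.range N,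
      1 / √(k+1:ℝ) * (1 / √(l+1:ℝ)) * (1 / ((k:ℝ) + l + 1)) := by
  have hs : Summable (fun k : ℕ => 1 / (k+1:ℝ) * (1 / √(k+1:ℝ))) := by
    have := (summable_nat_add_iff 1).2 (Real.summable_one_div_nat_rpow.2 (show (1:ℝ) < 3/2 by norm_num))
    refine this.congr fun k => ?_
    push_cast
    rw [Real.sqrt_eq_rpow, div_mul_div_comm, one_mul]
    congr 1
    rw [show (3/2:ℝ) = 1 + 1/2 by norm_num, Real.rpow_add (by positivity), Real.rpow_one]
  refine ⟨4 + 2 * ∑' k : ℕ, 1 / (k+1:ℝ) * (1 / √(k+1:ℝ)), fun N => ?_⟩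
  have h1 : ∀ k ∈ Finset.range N, Real.pi * (1 / (k+1:ℝ)) - 2 / √(N+1:ℝ) * (1 / √(k+1:ℝ))
      - 2 * (1 / (k+1:ℝ) * (1 / √(k+1:ℝ))) ≤ ∑ l ∈ Finset.range N,
      1 / √(k+1:ℝ) * (1 / √(l+1:ℝ)) * (1 / ((k:ℝ) + l + 1)) := by
    intro k _
    have h := hm_low_row (k+1) (by linarith [k.cast_nonneg (α := ℝ)]) N
    have k0 : 0 < √(k+1:ℝ) := Real.sqrt_pos.2 (by positivity)
    have s2 : √(k+1:ℝ) * √(k+1:ℝ) = k+1 := Real.mul_self_sqrt (by positivity)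
    have h' := mul_le_mul_of_nonneg_left h (one_div_pos.2 k0).le
    have e : 1 / √(k+1:ℝ) * (Real.pi / √(k+1:ℝ) - 2 / √(N+1:ℝ) - 2 / (k+1:ℝ)) =
        Real.pi * (1 / (k+1:ℝ)) - 2 / √(N+1:ℝ) * (1 / √(k+1:ℝ))
      - 2 * (1 / (k+1:ℝ) * (1 / √(k+1:ℝ))) := by
      rw [mul_sub, mul_sub, div_mul_div_comm 1 (√(k+1:ℝ)) Real.pi, s2]; ring
    rw [e] at h'
    refine h'.trans ?_
    rw [Finset.mul_sum]
    refine Finset.sum_le_sum fun l _ => ?_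
    have l0 : 0 < √(l+1:ℝ) := Real.sqrt_pos.2 (by positivity)
    rw [mul_assoc]
    refine mul_le_mul_of_nonneg_left ?_ (by positivity)
    rw [div_mul_div_comm, one_mul, mul_comm (√(l+1:ℝ))]
    gcongr 1 / (?_ * _)
    linarith
  refine le_trans ?_ (Finset.sum_le_sum h1)
  rw [Finset.sum_sub_distrib, Finset.sum_sub_distrib, ← Finset.mul_sum, ← Finset.mul_sum, ← Finset.mul_sum]
  have h2 := hs.sum_le_tsum (Finset.range N) (fun _ _ => by positivity)
  have h3 : 2 / √(N+1:ℝ) * ∑ k ∈ Finset.range N, 1 / √(k+1:ℝ) ≤ 4 := by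
    have n0 : 0 < √(N+1:ℝ) := Real.sqrt_pos.2 (by positivity)
    have : √(N:ℝ) ≤ √(N+1:ℝ) := Real.sqrt_le_sqrt (by linarith)
    rw [div_mul_eq_mul_div, div_le_iff₀ n0]
    linarith [hm_sum_inv_sqrt N]
  linarith

abbrev HmL := lp (fun _ : ℕ => ℝ) 2

lemma hm_sum_sq_le (x : HmL) (s : Finset ℕ) : ∑ i ∈ s, x i ^ 2 ≤ ‖x‖ ^ 2 := by
  have := lp.sum_rpow_le_norm_rpow (p := 2) (by norm_num) x s
  simpa using this

lemma hm_summable (x : HmL) (k : ℕ) : Summable (fun l : ℕ => 1 / ((k:ℝ) + l + 1) * x l) := by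
  have h1 : Summable (fun l : ℕ => (1 / ((k:ℝ) + l + 1))^2) := by
    have := (summable_nat_add_iff 1).2 (Real.summable_one_div_nat_pow.2 (show 1 < 2 by norm_num))
    refine this.of_nonneg_of_le (fun l => by positivity) fun l => ?_
    rw [div_pow, one_pow]
    push_cast
    gcongr
    linarith [k.cast_nonneg (α := ℝ)]
  have h2 : Summable (fun l : ℕ => (x l)^2) :=
    summable_of_sum_le (fun l => sq_nonneg _) (hm_sum_sq_le x)
  refine Summable.of_norm_bounded (h1.add h2) fun l => ?_
  rw [Real.norm_eq_abs, abs_mul, ← sq_abs (1 / ((k:ℝ) + l + 1)), ← sq_abs (x l)]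
  nlinarith [sq_nonneg (|1 / ((k:ℝ) + l + 1)| - |x l|), sq_nonneg (|1 / ((k:ℝ) + l + 1)|),
    sq_nonneg (|x l|)]

lemma hm_bound (x : HmL) (s : Finset ℕ) :
    ∑ k ∈ s, (∑' l : ℕ, 1 / ((k:ℝ) + l + 1) * x l) ^ 2 ≤ (Real.pi * ‖x‖) ^ 2 := by
  have h : Filter.Tendsto (fun t : Finset ℕ => ∑ k ∈ s, (∑ l ∈ t, 1 / ((k:ℝ) + l + 1) * x l)^2)
      Filter.atTop (nhds (∑ k ∈ s, (∑' l : ℕ, 1 / ((k:ℝ) + l + 1) * x l) ^ 2)) :=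
    tendsto_finsetSum _ fun k _ => (hm_summable x k).hasSum.pow 2
  refine le_of_tendsto' h fun t => (hm_schur s t x).trans ?_
  rw [mul_pow]
  exact mul_le_mul_of_nonneg_left (hm_sum_sq_le x t) (by positivity)

noncomputable def hmLin : HmL →ₗ[ℝ] HmL where
  toFun x := ⟨fun k => ∑' l : ℕ, 1 / ((k:ℝ) + l + 1) * x l,
    memℓp_gen' (C := (Real.pi * ‖x‖) ^ 2) fun s => by simpa using hm_bound x s⟩
  map_add' x y := by
    ext k
    simp only [lp.coeFn_add, Pi.add_apply, mul_add]
    exact (hm_summable x k).tsum_add (hm_summable y k)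
  map_smul' c x := by
    ext k
    simp only [lp.coeFn_smul, Pi.smul_apply, smul_eq_mul, RingHom.id_apply]
    rw [← tsum_mul_left]
    exact tsum_congr fun l => by ring

lemma hmLin_apply (x : HmL) (k : ℕ) : hmLin x k = ∑' l : ℕ, 1 / ((k:ℝ) + l + 1) * x l := rfl

lemma hmLin_norm (x : HmL) : ‖hmLin x‖ ≤ Real.pi * ‖x‖ := by
  refine lp.norm_le_of_forall_sum_le (by norm_num) (by positivity) fun s => ?_
  simpa [hmLin_apply] using hm_bound x s

theorem hilbert_matrix_norm_eq_pi :
    ∃ A : lp (fun _ : ℕ => ℝ) 2 →L[ℝ] lp (fun _ : ℕ => ℝ) 2,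
      (∀ k l : ℕ, (A (lp.single 2 l (1 : ℝ)) : ∀ _ : ℕ, ℝ) k = 1 / ((k : ℝ) + l + 1)) ∧
      ‖A‖ = Real.pi ∧
      ∀ γ δ : lp (fun _ : ℕ => ℝ) 2, ‖γ‖ = 1 → ‖δ‖ = 1 →
        |∑' kl : ℕ × ℕ, (γ : ∀ _ : ℕ, ℝ) kl.1 * (δ : ∀ _ : ℕ, ℝ) kl.2 /
            ((kl.1 : ℝ) + kl.2 + 1)| ≤ Real.pi := by
  let A : HmL →L[ℝ] HmL := hmLin.mkContinuous Real.pi hmLin_norm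
  have hA : ∀ k l : ℕ, (A (lp.single 2 l (1 : ℝ)) : ∀ _ : ℕ, ℝ) k = 1 / ((k : ℝ) + l + 1) := by
    intro k l
    change ∑' j : ℕ, 1 / ((k:ℝ) + j + 1) * (lp.single 2 l (1 : ℝ) : HmL) j = _
    rw [tsum_eq_single l]
    · simp
    · intro j hj
      simp [hj]
  refine ⟨A, hA, le_antisymm (LinearMap.mkContinuous_norm_le _ Real.pi_pos.le _) ?_, ?_⟩
  · obtain ⟨C, hC⟩ := hm_low
    by_contra! hlt
    have key : ∀ N : ℕ, (Real.pi - ‖A‖) * ∑ k ∈ Finset.range N, 1 / (k+1:ℝ) ≤ C := by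
      intro N
      let x : HmL := ∑ k ∈ Finset.range N, lp.single 2 k (1 / √(k+1:ℝ))
      have hx : ‖x‖^2 = ∑ k ∈ Finset.range N, 1 / (k+1:ℝ) := by
        have := lp.norm_sum_single (E := fun _ : ℕ => ℝ) (p := 2) (by norm_num)
          (fun k => 1 / √(k+1:ℝ)) (Finset.range N)
        simp only [ENNReal.toReal_ofNat, Real.rpow_ofNat] at this
        rw [this]
        refine Finset.sum_congr rfl fun k _ => ?_
        rw [Real.norm_eq_abs, sq_abs, div_pow, one_pow, Real.sq_sqrt (by positivity)]
      have hs : ∀ k : ℕ, (lp.single 2 k (1 / √(k+1:ℝ)) : HmL) = (1 / √(k+1:ℝ)) • lp.single 2 k (1:ℝ) := by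
        intro k
        rw [← lp.single_smul, smul_eq_mul, mul_one]
      have hin : inner ℝ x (A x) = ∑ k ∈ Finset.range N, ∑ l ∈ Finset.range N,
          1 / √(k+1:ℝ) * (1 / √(l+1:ℝ)) * (1 / ((k:ℝ) + l + 1)) := by
        simp only [x]
        rw [map_sum, sum_inner]
        refine Finset.sum_congr rfl fun k _ => ?_
        rw [inner_sum]
        refine Finset.sum_congr rfl fun l _ => ?_
        rw [hs l, map_smul, inner_smul_right, lp.inner_single_left, hA]
        simp
        ring
      have h1 := real_inner_le_norm x (A x)
      have h2 := A.le_opNorm x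
      have h3 := hC N
      rw [← hin] at h3
      have h4 : ‖x‖ * ‖A x‖ ≤ ‖A‖ * ‖x‖^2 := by
        nlinarith [norm_nonneg x]
      rw [hx] at h4
      linarith
    have ht := Real.tendsto_sum_range_one_div_nat_succ_atTop.const_mul_atTop (sub_pos.2 hlt)
    obtain ⟨N, hN⟩ := (ht.eventually_gt_atTop C).exists
    exact absurd (key N) (not_le.2 hN)
  · intro γ δ hγ hδ
    by_cases hs : Summable (fun kl : ℕ × ℕ => (γ : ∀ _ : ℕ, ℝ) kl.1 * (δ : ∀ _ : ℕ, ℝ) kl.2 /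
            ((kl.1 : ℝ) + kl.2 + 1))
    swap
    · rw [tsum_eq_zero_of_not_summable hs, abs_zero]
      exact Real.pi_pos.le
    have hT : Filter.Tendsto (fun s : Finset ℕ => s ×ˢ s) Filter.atTop Filter.atTop := by
      refine Filter.tendsto_atTop_atTop.2 fun b => ⟨b.image Prod.fst ∪ b.image Prod.snd, fun s hs => ?_⟩
      intro p hp
      rw [Finset.mem_product]
      exact ⟨hs (Finset.mem_union_left _ (Finset.mem_image_of_mem _ hp)),
        hs (Finset.mem_union_right _ (Finset.mem_image_of_mem _ hp))⟩
    refine le_of_tendsto' ((hs.hasSum.comp hT).abs) fun s => ?_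
    simp only [Function.comp]
    refine abs_le_of_sq_le_sq ?_ Real.pi_pos.le
    have e : ∑ kl ∈ s ×ˢ s, (γ : ∀ _ : ℕ, ℝ) kl.1 * (δ : ∀ _ : ℕ, ℝ) kl.2 /
            ((kl.1 : ℝ) + kl.2 + 1) = ∑ k ∈ s, γ k * ∑ l ∈ s, 1 / ((k:ℝ) + l + 1) * δ l := by
      rw [Finset.sum_product]
      refine Finset.sum_congr rfl fun k _ => ?_
      rw [Finset.mul_sum]
      exact Finset.sum_congr rfl fun l _ => by ring
    rw [e]
    have h1 := hm_sum_sq_le γ s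
    have h2 := hm_sum_sq_le δ s
    rw [hγ, one_pow] at h1
    rw [hδ, one_pow] at h2
    calc _ ≤ (∑ k ∈ s, γ k ^ 2) * ∑ k ∈ s, (∑ l ∈ s, 1 / ((k:ℝ) + l + 1) * δ l)^2 :=
          Finset.sum_mul_sq_le_sq_mul_sq _ _ _
      _ ≤ 1 * (Real.pi^2 * ∑ l ∈ s, δ l ^ 2) :=
          mul_le_mul h1 (hm_schur s s δ) (Finset.sum_nonneg fun _ _ => sq_nonneg _) zero_le_one
      _ ≤ Real.pi^2 := by nlinarith [sq_nonneg Real.pi]
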